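/- Let k ≥ 2 be an integer and let U_1^{ev} = {z ∈ ℤ^k : gcd(z) = 1 and ‖z‖_1 is even} denote the set of visible elements of ℤ^k of even ℓ_1-length. Then the strict asymptotic density of U_1^{ev} with respect to the sup-norm equals (2^{k−1} − 1)/((2^k − 1) ζ(k)); that is, lim_{n→∞} #{z ∈ ℤ^k : ‖z‖_∞ ≤ n, gcd(z) = 1, ‖z‖_1 even} / #{z ∈ ℤ^k : ‖z‖_∞ ≤ n} = (2^{k−1} − 1)/((2^k − 1) ζ(k)). -/

import Mathlib

open Filter

/-- The Riemann zeta function at a natural number argument, ζ(k) = Σ_{m≥1} m^{-k}. -/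
noncomputable def zetaR (r : ℕ) : ℝ := ∑' m : ℕ, 1 / ((m : ℝ) + 1) ^ r

open ArithmeticFunction in
/-- The sum of the Möbius function over the divisors of a positive integer. -/
theorem sum_moebius_filter_dvd {g n : ℕ} (hg : g ≠ 0) (hgn : g ≤ n) :
    ∑ d ∈ Finset.range (n + 1) with d ∣ g, moebius d = if g = 1 then 1 else 0 := by
  have h : ∑ d ∈ g.divisors, moebius d = if g = 1 then 1 else 0 := by
    rw [← coe_mul_zeta_apply, moebius_mul_coe_zeta, one_apply]
  rw [← h]
  refine Finset.sum_congr ?_ fun _ _ => rfl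
  ext d
  simp only [Finset.mem_filter, Finset.mem_range, Nat.mem_divisors]
  exact ⟨fun h => ⟨h.2, hg⟩, fun h => ⟨by have := Nat.le_of_dvd (by omega) h.1; omega, h.1⟩⟩

/-- The integer points of sup-norm at most `N`. -/
noncomputable abbrev supBox (k N : ℕ) : Finset (Fin k → ℤ) :=
  Fintype.piFinset fun _ => Finset.Icc (-(N : ℤ)) N

theorem mem_supBox {k N : ℕ} {z : Fin k → ℤ} : z ∈ supBox k N ↔ ∀ i, |z i| ≤ (N : ℤ) := by
  simp [supBox, abs_le]

theorem card_supBox (k N : ℕ) : (supBox k N).card = (2 * N + 1) ^ k := by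
  simp only [supBox, Fintype.card_piFinset_const, Int.card_Icc]
  congr 1
  omega

theorem sum_Icc_neg_one_pow_natAbs (N : ℕ) :
    ∑ j ∈ Finset.Icc (-(N : ℤ)) N, (-1 : ℝ) ^ j.natAbs = (-1) ^ N := by
  induction N with
  | zero => simp
  | succ N ih =>
    have : Finset.Icc (-((N + 1 : ℕ) : ℤ)) ((N + 1 : ℕ) : ℤ) =
        insert (-((N + 1 : ℕ) : ℤ)) (insert ((N + 1 : ℕ) : ℤ) (Finset.Icc (-(N : ℤ)) N)) := by
      ext x
      simp only [Finset.mem_insert, Finset.mem_Icc]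
      omega
    rw [this, Finset.sum_insert (by simp only [Finset.mem_insert, Finset.mem_Icc]; omega),
      Finset.sum_insert (by simp only [Finset.mem_Icc]; omega), ih, Int.natAbs_neg,
      Int.natAbs_natCast, pow_succ]
    ring

/-- The signed count of the points of a box, each point `w` carrying the parity of
`‖d • w‖_1`. -/
theorem sum_supBox_neg_one_pow (k N d : ℕ) :
    ∑ w ∈ supBox k N, ((-1 : ℝ) ^ d) ^ (∑ i, (w i).natAbs) =
      if Even d then (2 * N + 1 : ℝ) ^ k else ((-1) ^ N) ^ k := by
  split_ifs with hd
  · simp only [hd.neg_one_pow, one_pow, Finset.sum_const, card_supBox, nsmul_eq_mul, mul_one]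
    push_cast
    rfl
  · rw [Nat.not_even_iff_odd] at hd
    simp only [hd.neg_one_pow, ← Finset.prod_pow_eq_pow_sum]
    rw [← sum_Icc_neg_one_pow_natAbs, Finset.sum_pow']

/-- The number of nonzero `z ∈ ℤ^k` of even ℓ_1-length, divisible by `d` and with
`‖z‖_∞ ≤ d * N`. -/
noncomputable def evenMultipleCount (k N d : ℕ) : ℝ :=
  ((2 * N + 1) ^ k + if Even d then (2 * N + 1 : ℝ) ^ k else ((-1) ^ N) ^ k) / 2 - 1

theorem card_filter_even_mul (k N d : ℕ) :
    (((supBox k N).filter fun w => w ≠ 0 ∧ Even (d * ∑ i, (w i).natAbs)).card : ℝ) =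
      evenMultipleCount k N d := by
  have h : ∀ w ∈ supBox k N, (if w ≠ 0 ∧ Even (d * ∑ i, (w i).natAbs) then (1 : ℝ) else 0) =
      (1 + ((-1 : ℝ) ^ d) ^ (∑ i, (w i).natAbs)) / 2 - if w = 0 then 1 else 0 := by
    intro w _
    rw [← pow_mul]
    by_cases hw : w = 0
    · simp [hw]
    · rcases Nat.even_or_odd (d * ∑ i, (w i).natAbs) with he | ho
      · simp [hw, he, he.neg_one_pow]
      · simp [hw, Nat.not_even_iff_odd.mpr ho, ho.neg_one_pow]
  rw [Finset.card_filter]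
  push_cast
  rw [Finset.sum_congr rfl h, Finset.sum_sub_distrib, ← Finset.sum_div, Finset.sum_add_distrib,
    sum_supBox_neg_one_pow, Finset.sum_ite_eq', if_pos (mem_supBox.mpr (by simp)),
    Finset.sum_const, card_supBox, evenMultipleCount]
  simp

theorem card_filter_dvd (k n : ℕ) {d : ℕ} (hd : d ≠ 0) :
    (((supBox k n).filter fun z =>
      (z ≠ 0 ∧ Even (∑ i, (z i).natAbs)) ∧ ∀ i, (d : ℤ) ∣ z i).card : ℝ) =
      evenMultipleCount k (n / d) d := by
  have hd' : (d : ℤ) ≠ 0 := by exact_mod_cast hd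
  rw [← card_filter_even_mul]
  have hinj : Function.Injective fun w : Fin k → ℤ => (d : ℤ) • w := smul_right_injective _ hd'
  rw [← Finset.card_image_of_injective ((supBox k (n / d)).filter _) hinj]
  congr 2
  have hnorm (w : Fin k → ℤ) :
      ∑ i, (((d : ℤ) • w) i).natAbs = d * ∑ i, (w i).natAbs := by
    simp [Int.natAbs_mul, Finset.mul_sum]
  have hbox (w : Fin k → ℤ) : (d : ℤ) • w ∈ supBox k n ↔ w ∈ supBox k (n / d) := by
    simp only [mem_supBox, Pi.smul_apply, smul_eq_mul, abs_mul, Nat.abs_cast]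
    refine forall_congr' fun i => ?_
    push_cast
    rw [Int.le_ediv_iff_mul_le (by positivity), mul_comm]
  ext z
  simp only [Finset.mem_filter, Finset.mem_image]
  constructor
  · rintro ⟨hz, ⟨h0, he⟩, hdvd⟩
    choose w hw using hdvd
    obtain rfl : z = (d : ℤ) • w := funext hw
    exact ⟨w, ⟨(hbox w).mp hz, fun h => h0 (by simp [h]), by rwa [← hnorm]⟩, rfl⟩
  · rintro ⟨w, ⟨hw, h0, he⟩, rfl⟩
    exact ⟨(hbox w).mpr hw, ⟨smul_ne_zero hd' h0, by rwa [hnorm]⟩, fun i => by simp⟩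

/-- Möbius inversion for the visible points of even ℓ_1-length in a box. -/
theorem ncard_visible_even (k n : ℕ) :
    ({z : Fin k → ℤ | (∀ i, |z i| ≤ (n : ℤ)) ∧ Finset.univ.gcd z = 1 ∧
      Even (∑ i, (z i).natAbs)}.ncard : ℝ) =
      ∑ d ∈ Finset.range (n + 1),
        (ArithmeticFunction.moebius d : ℝ) * evenMultipleCount k (n / d) d := by
  set S := (supBox k n).filter fun z => z ≠ 0 ∧ Even (∑ i, (z i).natAbs) with hS
  have hset : {z : Fin k → ℤ | (∀ i, |z i| ≤ (n : ℤ)) ∧ Finset.univ.gcd z = 1 ∧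
      Even (∑ i, (z i).natAbs)} = ↑(S.filter fun z => (Finset.univ.gcd z).natAbs = 1) := by
    ext z
    have hg : Finset.univ.gcd z = 1 ↔ (Finset.univ.gcd z).natAbs = 1 := by
      have : 0 ≤ Finset.univ.gcd z := by
        rw [← Finset.normalize_gcd, ← Int.abs_eq_normalize]
        exact abs_nonneg _
      omega
    simp only [hS, Set.mem_ofPred_eq, Finset.coe_filter, Finset.mem_filter, mem_supBox, hg]
    constructor
    · rintro ⟨h1, h2, h3⟩
      refine ⟨⟨h1, ?_, h3⟩, h2⟩
      rintro rfl
      have : Finset.univ.gcd (0 : Fin k → ℤ) = 0 := Finset.gcd_eq_zero_iff.mpr fun _ _ => rfl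
      simp [this] at h2
    · rintro ⟨⟨h1, _, h3⟩, h2⟩
      exact ⟨h1, h2, h3⟩
  rw [hset, Set.ncard_coe_finset, Finset.card_filter]
  push_cast
  have hpoint : ∀ z ∈ S, (if (Finset.univ.gcd z).natAbs = 1 then (1 : ℝ) else 0) =
      ∑ d ∈ Finset.range (n + 1),
        if ∀ i, (d : ℤ) ∣ z i then (ArithmeticFunction.moebius d : ℝ) else 0 := by
    intro z hz
    obtain ⟨hbox, h0, -⟩ := Finset.mem_filter.mp hz
    obtain ⟨i, hi⟩ := Function.ne_iff.mp h0
    have hdvd : (Finset.univ.gcd z) ∣ z i := Finset.gcd_dvd (Finset.mem_univ i)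
    have hg : (Finset.univ.gcd z).natAbs ≠ 0 := by
      rw [Int.natAbs_ne_zero]
      rintro h
      exact hi (Finset.gcd_eq_zero_iff.mp h i (Finset.mem_univ i))
    have hgn : (Finset.univ.gcd z).natAbs ≤ n := by
      have h1 := Nat.le_of_dvd (Int.natAbs_pos.mpr (by simpa using hi)) (Int.natAbs_dvd_natAbs.mpr hdvd)
      have h2 := mem_supBox.mp hbox i
      rw [Int.abs_eq_natAbs] at h2
      omega
    have h := congrArg (Int.cast : ℤ → ℝ) (sum_moebius_filter_dvd hg hgn)
    rw [Finset.sum_filter] at h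
    push_cast at h
    rw [← h]
    refine Finset.sum_congr rfl fun d _ => ?_
    simp only [← Int.natCast_dvd, Finset.dvd_gcd_iff, Finset.mem_univ, true_imp_iff]
  rw [Finset.sum_congr rfl hpoint, Finset.sum_comm]
  refine Finset.sum_congr rfl fun d _ => ?_
  rcases eq_or_ne d 0 with rfl | hd
  · simp
  · rw [← card_filter_dvd k n hd, ← Finset.sum_filter, Finset.sum_const, nsmul_eq_mul, hS,
      Finset.filter_filter, mul_comm]

theorem tendsto_floor_box_ratio {d : ℕ} (hd : d ≠ 0) :
    Tendsto (fun n : ℕ => (2 * (n / d : ℕ) + 1 : ℝ) / (2 * n + 1)) atTop (nhds (1 / d)) := by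
  have hd' : (1 : ℝ) ≤ d := by exact_mod_cast Nat.one_le_iff_ne_zero.mpr hd
  rw [tendsto_iff_norm_sub_tendsto_zero]
  refine squeeze_zero (fun _ => norm_nonneg _) (fun n => ?_)
    (tendsto_one_div_add_atTop_nhds_zero_nat (𝕜 := ℝ))
  have h1 : (d : ℝ) * (n / d : ℕ) + (n % d : ℕ) = n := by exact_mod_cast Nat.div_add_mod n d
  have h2 : ((n % d : ℕ) : ℝ) + 1 ≤ d := by
    exact_mod_cast Nat.mod_lt n (Nat.pos_of_ne_zero hd)
  have h3 : (0 : ℝ) ≤ (n % d : ℕ) := Nat.cast_nonneg _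
  have h4 : (0 : ℝ) ≤ n := Nat.cast_nonneg _
  have hd0 : (0 : ℝ) < d := by linarith
  have key : (2 * (n / d : ℕ) + 1 : ℝ) / (2 * n + 1) - 1 / d =
      (d - 1 - 2 * (n % d : ℕ)) / d / (2 * n + 1) := by
    field_simp
    linear_combination (2 : ℝ) * h1
  rw [key, Real.norm_eq_abs, abs_div, abs_of_pos (by positivity : (0 : ℝ) < 2 * n + 1)]
  refine div_le_div₀ zero_le_one ?_ (by positivity) (by linarith)
  rw [abs_div, abs_of_pos hd0, div_le_one hd0, abs_le]
  constructor <;> linarith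

theorem tendsto_evenMultipleCount {k d : ℕ} (hk : k ≠ 0) (hd : d ≠ 0) :
    Tendsto (fun n : ℕ => evenMultipleCount k (n / d) d / (2 * n + 1 : ℝ) ^ k) atTop
      (nhds ((1 / d ^ k + if Even d then 1 / (d : ℝ) ^ k else 0) / 2)) := by
  have hmain : Tendsto (fun n : ℕ => (2 * (n / d : ℕ) + 1 : ℝ) ^ k / (2 * n + 1 : ℝ) ^ k) atTop
      (nhds (1 / (d : ℝ) ^ k)) := by
    simpa only [div_pow, one_pow] using (tendsto_floor_box_ratio hd).pow k
  have hden : Tendsto (fun n : ℕ => (2 * n + 1 : ℝ) ^ k) atTop atTop :=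
    (tendsto_pow_atTop hk).comp <| tendsto_atTop_add_const_right _ _ <|
      (tendsto_natCast_atTop_atTop (R := ℝ)).const_mul_atTop two_pos
  have hone : Tendsto (fun n : ℕ => 1 / (2 * n + 1 : ℝ) ^ k) atTop (nhds 0) := by
    simpa only [one_div] using! hden.inv_tendsto_atTop
  have hsigned : Tendsto (fun n : ℕ => (if Even d then (2 * (n / d : ℕ) + 1 : ℝ) ^ k
      else ((-1) ^ (n / d)) ^ k) / (2 * n + 1 : ℝ) ^ k) atTop
      (nhds (if Even d then 1 / (d : ℝ) ^ k else 0)) := by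
    split_ifs
    · exact hmain
    · refine squeeze_zero_norm (fun n => le_of_eq ?_) hone
      rw [norm_div, norm_pow, norm_pow, norm_neg, norm_one, one_pow, one_pow,
        Real.norm_of_nonneg (by positivity)]
  have := ((hmain.add hsigned).div_const 2).sub hone
  rw [sub_zero] at this
  refine this.congr fun n => ?_
  rw [evenMultipleCount]
  ring

theorem abs_evenMultipleCount_le (k N d : ℕ) :
    |evenMultipleCount k N d| ≤ (2 * N + 1 : ℝ) ^ k := by
  have h1 : (1 : ℝ) ≤ (2 * N + 1 : ℝ) ^ k := one_le_pow₀ (by linarith [N.cast_nonneg (α := ℝ)])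
  have h2 : |if Even d then (2 * N + 1 : ℝ) ^ k else ((-1) ^ N) ^ k| ≤ (2 * N + 1 : ℝ) ^ k := by
    split_ifs
    · rw [abs_of_nonneg (by linarith)]
    · simpa [abs_pow] using h1
  rw [abs_le] at h2 ⊢
  rw [evenMultipleCount]
  constructor <;> linarith

theorem evenMultipleCount_zero (k d : ℕ) : evenMultipleCount k 0 d = 0 := by
  simp [evenMultipleCount]

theorem abs_evenMultipleCount_div_le (k n d : ℕ) (hd : d ≠ 0) :
    |evenMultipleCount k (n / d) d / (2 * n + 1 : ℝ) ^ k| ≤ 2 ^ k * (1 / (d : ℝ) ^ k) := by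
  rcases Nat.eq_zero_or_pos (n / d) with h | h
  · rw [h, evenMultipleCount_zero, zero_div, abs_zero]
    positivity
  · have hd0 : (0 : ℝ) < d := by exact_mod_cast Nat.pos_of_ne_zero hd
    have h1 : (1 : ℝ) ≤ (n / d : ℕ) := by exact_mod_cast h
    have h2 : (d : ℝ) * (n / d : ℕ) ≤ n := by exact_mod_cast Nat.mul_div_le n d
    have h4 : (0 : ℝ) ≤ n := Nat.cast_nonneg _
    have hratio : (2 * (n / d : ℕ) + 1 : ℝ) / (2 * n + 1) ≤ 2 / d := by
      rw [div_le_div_iff₀ (by positivity) hd0]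
      nlinarith
    calc |evenMultipleCount k (n / d) d / (2 * n + 1 : ℝ) ^ k|
        = |evenMultipleCount k (n / d) d| / (2 * n + 1 : ℝ) ^ k := by
          rw [abs_div, abs_of_pos (by positivity : (0 : ℝ) < (2 * n + 1 : ℝ) ^ k)]
      _ ≤ (2 * (n / d : ℕ) + 1 : ℝ) ^ k / (2 * n + 1 : ℝ) ^ k := by
          gcongr
          exact abs_evenMultipleCount_le _ _ _
      _ = ((2 * (n / d : ℕ) + 1 : ℝ) / (2 * n + 1)) ^ k := (div_pow _ _ _).symm
      _ ≤ (2 / d) ^ k := by gcongr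
      _ = 2 ^ k * (1 / (d : ℝ) ^ k) := by rw [div_pow]; ring

theorem abs_moebius_cast_le_one (d : ℕ) : |(ArithmeticFunction.moebius d : ℝ)| ≤ 1 := by
  exact_mod_cast ArithmeticFunction.abs_moebius_le_one (n := d)

theorem summable_moebius_div_pow {k : ℕ} (hk : 2 ≤ k) :
    Summable fun d : ℕ => (ArithmeticFunction.moebius d : ℝ) / (d : ℝ) ^ k := by
  refine Summable.of_norm_bounded (Real.summable_one_div_nat_pow.mpr hk) fun d => ?_
  rw [norm_div, Real.norm_eq_abs, norm_pow, Real.norm_natCast]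
  gcongr
  exact abs_moebius_cast_le_one d

theorem tsum_moebius_div_pow {k : ℕ} (hk : 2 ≤ k) :
    ∑' d : ℕ, (ArithmeticFunction.moebius d : ℝ) / (d : ℝ) ^ k = 1 / zetaR k := by
  have hs : 1 < (k : ℂ).re := by
    rw [Complex.natCast_re]
    exact_mod_cast hk
  have h := ArithmeticFunction.LSeries_zeta_mul_Lseries_moebius hs
  rw [ArithmeticFunction.LSeries_zeta_eq_riemannZeta hs] at h
  have hz : riemannZeta k = (zetaR k : ℂ) := by
    have := zeta_eq_tsum_one_div_nat_add_one_cpow hs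
    rw [this, zetaR]
    push_cast
    simp only [Complex.cpow_natCast]
  have hm : LSeries (fun n => ((ArithmeticFunction.moebius n : ℤ) : ℂ)) k =
      ((∑' d : ℕ, (ArithmeticFunction.moebius d : ℝ) / (d : ℝ) ^ k : ℝ) : ℂ) := by
    rw [LSeries]
    push_cast
    refine tsum_congr fun d => ?_
    rw [LSeries.term_def]
    split_ifs with h0
    · simp [h0]
    · rw [Complex.cpow_natCast]
  rw [hz, hm] at h
  have h' : zetaR k * ∑' d : ℕ, (ArithmeticFunction.moebius d : ℝ) / (d : ℝ) ^ k = 1 := by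
    exact_mod_cast h
  exact eq_one_div_of_mul_eq_one_right h'

theorem moebius_two_mul_odd (m : ℕ) :
    ArithmeticFunction.moebius (2 * (2 * m + 1)) = -ArithmeticFunction.moebius (2 * m + 1) := by
  rw [ArithmeticFunction.isMultiplicative_moebius.map_mul_of_coprime (by simp),
    ArithmeticFunction.moebius_apply_prime Nat.prime_two, neg_one_mul]

theorem moebius_two_mul_even (m : ℕ) : ArithmeticFunction.moebius (2 * (2 * m)) = 0 := by
  refine ArithmeticFunction.moebius_eq_zero_of_not_squarefree fun h => ?_
  simpa using h 2 ⟨m, by ring⟩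

theorem injective_two_mul : Function.Injective fun m : ℕ => 2 * m :=
  fun _ _ h => Nat.eq_of_mul_eq_mul_left two_pos h

theorem injective_two_mul_add_one : Function.Injective fun m : ℕ => 2 * m + 1 :=
  fun _ _ h => injective_two_mul (Nat.succ_injective h)

/-- The even part of a series that vanishes at multiples of `4` and scales by `c` from an odd
number to its double. -/
theorem tsum_two_mul_of_scaling {f : ℕ → ℝ} (hf : Summable f) {c : ℝ}
    (h0 : ∀ m, f (2 * (2 * m)) = 0) (h1 : ∀ m, f (2 * (2 * m + 1)) = c * f (2 * m + 1)) :
    (∑' m, f (2 * m)) * (1 + c) = c * ∑' m, f m := by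
  have hE : Summable fun m => f (2 * m) := hf.comp_injective injective_two_mul
  have htotal := tsum_even_add_odd hE (hf.comp_injective injective_two_mul_add_one)
  have hsplit := tsum_even_add_odd (f := fun m => f (2 * m)) (hE.comp_injective injective_two_mul)
    (hE.comp_injective injective_two_mul_add_one)
  simp only [h0, h1, tsum_zero, tsum_mul_left, zero_add] at hsplit
  rw [← htotal]
  linear_combination -hsplit

theorem tsum_moebius_even {k : ℕ} (hk : 2 ≤ k) :
    ∑' m : ℕ, (ArithmeticFunction.moebius (2 * m) : ℝ) / ((2 * m : ℕ) : ℝ) ^ k =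
      -(1 / zetaR k) / (2 ^ k - 1) := by
  have h := tsum_two_mul_of_scaling (summable_moebius_div_pow hk) (c := -(1 / 2 ^ k))
    (fun m => by rw [moebius_two_mul_even, Int.cast_zero, zero_div])
    (fun m => by
      rw [moebius_two_mul_odd, Nat.cast_mul, mul_pow]
      push_cast
      ring)
  rw [tsum_moebius_div_pow hk] at h
  have h2 : (1 : ℝ) < 2 ^ k := one_lt_pow₀ one_lt_two (by omega)
  rw [eq_div_iff (by linarith)]
  have h3 : (2 : ℝ) ^ k * (1 / 2 ^ k) = 1 := mul_one_div_cancel (by positivity)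
  generalize ∑' m : ℕ, (ArithmeticFunction.moebius (2 * m) : ℝ) / ((2 * m : ℕ) : ℝ) ^ k = e at h ⊢
  linear_combination (2 : ℝ) ^ k * h + (e - 1 / zetaR k) * h3

theorem tsum_moebius_mul_limit {k : ℕ} (hk : 2 ≤ k) :
    ∑' d : ℕ, (ArithmeticFunction.moebius d : ℝ) *
      ((1 / d ^ k + if Even d then 1 / (d : ℝ) ^ k else 0) / 2) =
      (2 ^ (k - 1) - 1 : ℝ) / ((2 ^ k - 1) * zetaR k) := by
  set f : ℕ → ℝ := fun d => (ArithmeticFunction.moebius d : ℝ) / (d : ℝ) ^ k with hf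
  set g : ℕ → ℝ := fun d => if Even d then f d else 0 with hg
  have hfs : Summable f := summable_moebius_div_pow hk
  have hgs : Summable g := by
    refine hfs.norm.of_norm_bounded fun d => ?_
    simp only [hg]
    split_ifs
    · exact le_rfl
    · simp
  have hgt : ∑' d, g d = -(1 / zetaR k) / (2 ^ k - 1) := by
    rw [← tsum_even_add_odd (hgs.comp_injective injective_two_mul)
        (hgs.comp_injective injective_two_mul_add_one),
      ← tsum_moebius_even hk]
    simp [hg, hf]
  have h : ∀ d : ℕ, (ArithmeticFunction.moebius d : ℝ) *
      ((1 / d ^ k + if Even d then 1 / (d : ℝ) ^ k else 0) / 2) = (f d + g d) / 2 := by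
    intro d
    simp only [hg, hf]
    split_ifs <;> ring
  rw [tsum_congr h, tsum_div_const, hfs.tsum_add hgs, hgt, tsum_moebius_div_pow hk]
  obtain ⟨j, rfl⟩ : ∃ j, k = j + 1 := ⟨k - 1, by omega⟩
  have h2 : (2 : ℝ) ^ (j + 1) - 1 ≠ 0 := by
    have : (1 : ℝ) < 2 ^ (j + 1) := one_lt_pow₀ one_lt_two (by omega)
    linarith
  rw [Nat.add_sub_cancel, ← div_div,
    div_eq_mul_one_div ((2 ^ j - 1 : ℝ) / _) (zetaR (j + 1))]
  generalize 1 / zetaR (j + 1) = s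
  field_simp
  ring

/-- For `k ≥ 2`, the strict asymptotic density, with respect to the sup-norm, of the set
`U_1^{ev}` of visible elements of `ℤ^k` of even ℓ_1-length equals
`(2^{k-1} - 1) / ((2^k - 1) ζ(k))`. -/
theorem stmt_6 (k : ℕ) (hk : 2 ≤ k) :
    Tendsto (fun n : ℕ =>
      (({z : Fin k → ℤ | (∀ i, |z i| ≤ (n : ℤ)) ∧ Finset.univ.gcd z = 1 ∧
          Even (∑ i, (z i).natAbs)}.ncard : ℝ)) /
        ({z : Fin k → ℤ | ∀ i, |z i| ≤ (n : ℤ)}.ncard : ℝ))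
      atTop (nhds ((2 ^ (k - 1) - 1 : ℝ) / ((2 ^ k - 1) * zetaR k))) := by
  have hbound : Summable fun d : ℕ => 2 ^ k * (1 / (d : ℝ) ^ k) :=
    (Real.summable_one_div_nat_pow.mpr hk).mul_left _
  have hlim := tendsto_tsum_of_dominated_convergence
    (f := fun (n d : ℕ) => (ArithmeticFunction.moebius d : ℝ) *
      (evenMultipleCount k (n / d) d / (2 * n + 1 : ℝ) ^ k))
    (g := fun d : ℕ => (ArithmeticFunction.moebius d : ℝ) *
      ((1 / d ^ k + if Even d then 1 / (d : ℝ) ^ k else 0) / 2))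
    (𝓕 := atTop) hbound
    (fun d => by
      rcases eq_or_ne d 0 with rfl | hd
      · simp
      · exact (tendsto_evenMultipleCount (by omega) hd).const_mul _)
    (Eventually.of_forall fun n d => by
      rcases eq_or_ne d 0 with rfl | hd
      · simp only [ArithmeticFunction.map_zero, Int.cast_zero, zero_mul, norm_zero]
        positivity
      · rw [norm_mul]
        refine (mul_le_of_le_one_left (norm_nonneg _) (abs_moebius_cast_le_one d)).trans ?_
        exact abs_evenMultipleCount_div_le k n d hd)
  rw [tsum_moebius_mul_limit hk] at hlim
  refine hlim.congr fun n => ?_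
  have hbox : {z : Fin k → ℤ | ∀ i, |z i| ≤ (n : ℤ)} = ↑(supBox k n) := by
    ext z
    rw [Finset.mem_coe, mem_supBox, Set.mem_ofPred_eq]
  rw [ncard_visible_even, hbox, Set.ncard_coe_finset, card_supBox, Finset.sum_div,
    tsum_eq_sum (s := Finset.range (n + 1))]
  · push_cast
    exact Finset.sum_congr rfl fun d _ => (mul_div_assoc _ _ _).symm
  · intro d hd
    rw [Nat.div_eq_of_lt (by simpa [Nat.succ_le_iff] using hd), evenMultipleCount_zero, zero_div,
      mul_zero]
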